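/- arXiv:2101.03593 — 3 statements merged into one kernel-verified Lean document; each statement's English description precedes it below -/
import Mathlib

section
/- (Soundness of A13) Restricting to frames that additionally satisfy R₂xxx for all x ∈ S, for all formulas A and B: ⊨ (A ∧ ¬B) → ¬(A → B). -/
inductive Formula (α : Type) : Type
  | atom : α → Formula α
  | neg : Formula α → Formula α
  | conj : Formula α → Formula α → Formula α
  | disj : Formula α → Formula α → Formula α
  | imp : Formula α → Formula α → Formula α

structure Frame (S : Type) : Type where
  S_nonempty : Nonempty S
  L : S → Prop
  L_nonempty : ∃ u, L u
  R1 : S → S → S → Prop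
  R2 : S → S → S → Prop
  le_refl : ∀ x, ∃ u, L u ∧ R1 u x x
  le_trans : ∀ x y z, (∃ u, L u ∧ R1 u x y) → (∃ u, L u ∧ R1 u y z) →
      (∃ u, L u ∧ R1 u x z)
  L_up : ∀ x y, L x → (∃ u, L u ∧ R1 u x y) → L y
  R1_down : ∀ w x y z, (∃ u, L u ∧ R1 u w x) → R1 x y z → R1 w y z
  R2_up : ∀ x w y z, (∃ u, L u ∧ R1 u x w) → R2 x y z → R2 w y z

def Frame.le {S : Type} (F : Frame S) (x y : S) : Prop := ∃ u, F.L u ∧ F.R1 u x y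

structure Model (S α : Type) : Type where
  F : Frame S
  vT : S → α → Prop
  vF : S → α → Prop
  persT : ∀ x y p, F.le x y → vT x p → vT y p
  persF : ∀ x y p, F.le x y → vF x p → vF y p

def Model.sat {S α : Type} (M : Model S α) : Formula α → S → Prop × Prop
  | .atom p, x => (M.vT x p, M.vF x p)
  | .neg A, x => ((M.sat A x).2, (M.sat A x).1)
  | .conj A B, x => ((M.sat A x).1 ∧ (M.sat B x).1, (M.sat A x).2 ∨ (M.sat B x).2)
  | .disj A B, x => ((M.sat A x).1 ∨ (M.sat B x).1, (M.sat A x).2 ∧ (M.sat B x).2)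
  | .imp A B, x =>
      ((∀ y z, M.F.R1 x y z → (M.sat A y).1 → (M.sat B z).1),
       (∃ y z, M.F.R2 x y z ∧ (M.sat A y).1 ∧ (M.sat B z).2))

def Model.satT {S α : Type} (M : Model S α) (x : S) (A : Formula α) : Prop := (M.sat A x).1

def Model.satF {S α : Type} (M : Model S α) (x : S) (A : Formula α) : Prop := (M.sat A x).2

def Entails (α : Type) (A B : Formula α) : Prop :=
  ∀ (S : Type) (M : Model S α) (x : S), M.satT x A → M.satT x B

def Valid (α : Type) (A : Formula α) : Prop :=
  ∀ (S : Type) (M : Model S α) (x : S), M.F.L x → M.satT x A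

/-- Truth and falsity of every formula persist along the order of the frame. -/
theorem Model.sat_mono {S α : Type} (M : Model S α) {x y : S} (h : M.F.le x y) (A : Formula α) :
    ((M.sat A x).1 → (M.sat A y).1) ∧ ((M.sat A x).2 → (M.sat A y).2) := by
  induction A with
  | atom p => exact ⟨M.persT x y p h, M.persF x y p h⟩
  | neg A ihA => exact ⟨ihA.2, ihA.1⟩
  | conj A B ihA ihB => exact ⟨And.imp ihA.1 ihB.1, Or.imp ihA.2 ihB.2⟩
  | disj A B ihA ihB => exact ⟨Or.imp ihA.1 ihB.1, And.imp ihA.2 ihB.2⟩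
  | imp A B =>
    refine ⟨fun hT a b hab => hT a b (M.F.R1_down x y a b h hab), ?_⟩
    rintro ⟨a, b, hab, hAB⟩
    exact ⟨a, b, M.F.R2_up x y a b h hab, hAB⟩

theorem soundness_A13 {α : Type} (A B : Formula α) :
    ∀ (S : Type) (M : Model S α), (∀ x : S, M.F.R2 x x x) →
      ∀ x : S, M.F.L x →
        M.satT x (Formula.imp (Formula.conj A (Formula.neg B))
          (Formula.neg (Formula.imp A B))) := by
  intro S M hR x hx y z hxyz hy
  have hz := (M.sat_mono ⟨x, hx, hxyz⟩ (A.conj B.neg)).1 hy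
  exact ⟨z, z, hR z, hz⟩
end

section
/- (Cut) For nonempty sets of formulas X, X′, Y, Y′ and any formula C: if X ∪ {C} ⊢ Y and X′ ⊢ Y′ ∪ {C}, then X ∪ X′ ⊢ Y ∪ Y′. -/
inductive Prov {α : Type} : Formula α → Prop
  | a1 (A : Formula α) : Prov (A.imp A)
  | a2l (A B : Formula α) : Prov (A.imp (A.disj B))
  | a2r (A B : Formula α) : Prov (B.imp (A.disj B))
  | a3l (A B : Formula α) : Prov ((A.conj B).imp A)
  | a3r (A B : Formula α) : Prov ((A.conj B).imp B)
  | a4 (A B C : Formula α) : Prov (((A.imp C).conj (B.imp C)).imp ((A.disj B).imp C))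
  | a5 (A B C : Formula α) : Prov (((A.imp B).conj (A.imp C)).imp (A.imp (B.conj C)))
  | a6 (A B C : Formula α) : Prov ((A.conj (B.disj C)).imp ((A.conj B).disj C))
  | a7l (A B : Formula α) : Prov ((A.disj B).neg.imp (A.neg.conj B.neg))
  | a7r (A B : Formula α) : Prov ((A.neg.conj B.neg).imp (A.disj B).neg)
  | a8l (A B : Formula α) : Prov ((A.conj B).neg.imp (A.neg.disj B.neg))
  | a8r (A B : Formula α) : Prov ((A.neg.disj B.neg).imp (A.conj B).neg)
  | a9l (A : Formula α) : Prov (A.imp A.neg.neg)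
  | a9r (A : Formula α) : Prov (A.neg.neg.imp A)
  | a10 (A B C : Formula α) :
      Prov (((A.disj B).imp C).neg.imp ((A.imp C).neg.disj ((B.imp C).neg)))
  | a11 (A B C : Formula α) :
      Prov ((A.imp (B.conj C)).neg.imp ((A.imp B).neg.disj ((A.imp C).neg)))
  | r1 {A B : Formula α} : Prov A → Prov (A.imp B) → Prov B
  | r2 {A B : Formula α} : Prov A → Prov B → Prov (A.conj B)
  | r3 {A B : Formula α} (C : Formula α) : Prov (A.imp B) → Prov ((C.imp A).imp (C.imp B))
  | r4 {A B : Formula α} (C : Formula α) : Prov (A.imp B) → Prov ((B.imp C).imp (A.imp C))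
  | r5 {A B : Formula α} (C : Formula α) :
      Prov (A.imp B) → Prov ((A.imp C).neg.imp ((B.imp C).neg))
  | r6 {A B : Formula α} (C : Formula α) :
      Prov (A.neg.imp B.neg) → Prov ((C.imp A).neg.imp ((C.imp B).neg))

def conjList {α : Type} : Formula α → List (Formula α) → Formula α
  | A, [] => A
  | A, B :: l => conjList (A.conj B) l

def disjList {α : Type} : Formula α → List (Formula α) → Formula α
  | A, [] => A
  | A, B :: l => disjList (A.disj B) l

/-- `X ⊢ B` : some finite nonempty conjunction of members of `X` provably implies `B`. -/
def SetProv {α : Type} (X : Set (Formula α)) (B : Formula α) : Prop :=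
  ∃ (A : Formula α) (l : List (Formula α)),
    A ∈ X ∧ (∀ C ∈ l, C ∈ X) ∧ Prov ((conjList A l).imp B)

/-- `X ⊢ Y` : `X` proves some finite nonempty disjunction of members of `Y`. -/
def SetProvSet {α : Type} (X Y : Set (Formula α)) : Prop :=
  ∃ (B : Formula α) (l : List (Formula α)),
    B ∈ Y ∧ (∀ C ∈ l, C ∈ Y) ∧ SetProv X (disjList B l)

def IsTheory {α : Type} (X : Set (Formula α)) : Prop :=
  X.Nonempty ∧ ∀ B, SetProv X B → B ∈ X

def IsPrime {α : Type} (X : Set (Formula α)) : Prop :=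
  ∀ A B : Formula α, A.disj B ∈ X ↔ (A ∈ X ∨ B ∈ X)

namespace Prov

variable {α : Type} {A B C : Formula α}

theorem trans (h : Prov (A.imp B)) (h' : Prov (B.imp C)) : Prov (A.imp C) :=
  r1 h (r3 A h')

theorem imp_conj (h : Prov (A.imp B)) (h' : Prov (A.imp C)) : Prov (A.imp (B.conj C)) :=
  r1 (r2 h h') (a5 A B C)

theorem disj_imp (h : Prov (A.imp C)) (h' : Prov (B.imp C)) : Prov ((A.disj B).imp C) :=
  r1 (r2 h h') (a4 A B C)

theorem conjList_imp_of_mem {l : List (Formula α)} (h : B ∈ A :: l) :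
    Prov ((conjList A l).imp B) := by
  induction l generalizing A B with
  | nil =>
    obtain rfl : B = A := by simpa using h
    exact a1 B
  | cons D l ih =>
    have head : Prov ((conjList (A.conj D) l).imp (A.conj D)) := ih (by simp)
    simp only [List.mem_cons] at h
    rcases h with rfl | rfl | h
    · exact head.trans (a3l _ _)
    · exact head.trans (a3r _ _)
    · exact ih (by simp [h])

theorem imp_conjList {l : List (Formula α)} (h : ∀ B ∈ A :: l, Prov (C.imp B)) :
    Prov (C.imp (conjList A l)) := by
  induction l generalizing A with
  | nil => exact h A (by simp)
  | cons D l ih =>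
    refine ih fun B hB => ?_
    rcases List.mem_cons.1 hB with rfl | hB
    · exact imp_conj (h A (by simp)) (h D (by simp))
    · exact h B (by simp [hB])

theorem imp_disjList_of_mem {l : List (Formula α)} (h : B ∈ A :: l) :
    Prov (B.imp (disjList A l)) := by
  induction l generalizing A B with
  | nil =>
    obtain rfl : B = A := by simpa using h
    exact a1 B
  | cons D l ih =>
    have head : Prov ((A.disj D).imp (disjList (A.disj D) l)) := ih (by simp)
    simp only [List.mem_cons] at h
    rcases h with rfl | rfl | h
    · exact (a2l _ _).trans head
    · exact (a2r _ _).trans head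
    · exact ih (by simp [h])

theorem disjList_imp {l : List (Formula α)} (h : ∀ B ∈ A :: l, Prov (B.imp C)) :
    Prov ((disjList A l).imp C) := by
  induction l generalizing A with
  | nil => exact h A (by simp)
  | cons D l ih =>
    refine ih fun B hB => ?_
    rcases List.mem_cons.1 hB with rfl | hB
    · exact disj_imp (h A (by simp)) (h D (by simp))
    · exact h B (by simp [hB])

/-- Cut for single formulas, obtained from the distribution axiom. -/
theorem cut_formula (h : Prov ((A.conj C).imp B)) (h' : Prov (A.imp (C.disj B))) :
    Prov (A.imp B) :=
  ((imp_conj (a1 A) h').trans (a6 A C B)).trans (disj_imp h (a1 B))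

end Prov

theorem cut {α : Type} (X X' Y Y' : Set (Formula α)) (C : Formula α)
    (hX : X.Nonempty) (hX' : X'.Nonempty) (hY : Y.Nonempty) (hY' : Y'.Nonempty)
    (h1 : SetProvSet (X ∪ {C}) Y) (h2 : SetProvSet X' (Y' ∪ {C})) :
    SetProvSet (X ∪ X') (Y ∪ Y') := by
  classical
  obtain ⟨B, m, hB, hm, A, l, hA, hl, h⟩ := h1
  obtain ⟨B', m', hB', hm', A', l', hA', hl', h'⟩ := h2
  have hAl : ∀ D ∈ A :: l, D ∈ X ∪ {C} := List.forall_mem_cons.2 ⟨hA, hl⟩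
  have hBm : ∀ D ∈ B' :: m', D ∈ Y' ∪ {C} := List.forall_mem_cons.2 ⟨hB', hm'⟩
  refine ⟨B, m ++ (B' :: m').filter (· ∈ Y'), Or.inl hB, fun D hD => ?_,
    A', l' ++ (A :: l).filter (· ∈ X), Or.inr hA', fun D hD => ?_, Prov.cut_formula (C := C) ?_ ?_⟩
  · rcases List.mem_append.1 hD with hD | hD
    · exact Or.inl (hm D hD)
    · exact Or.inr (by simpa using (List.mem_filter.1 hD).2)
  · rcases List.mem_append.1 hD with hD | hD
    · exact Or.inr (hl' D hD)
    · exact Or.inl (by simpa using (List.mem_filter.1 hD).2)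
  · refine (Prov.imp_conjList fun D hD => ?_).trans (h.trans (Prov.disjList_imp fun D hD => ?_))
    · rcases hAl D hD with hDX | rfl
      · refine (Prov.a3l _ _).trans (Prov.conjList_imp_of_mem ?_)
        exact List.mem_cons_of_mem _
          (List.mem_append_right _ (List.mem_filter.2 ⟨hD, by simpa using hDX⟩))
      · exact Prov.a3r _ _
    · exact Prov.imp_disjList_of_mem (List.mem_append_left (as := B :: m) _ hD)
  · refine (Prov.imp_conjList fun D hD => ?_).trans (h'.trans (Prov.disjList_imp fun D hD => ?_))
    · exact Prov.conjList_imp_of_mem (List.mem_append_left (as := A' :: l') _ hD)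
    · rcases hBm D hD with hDY | rfl
      · refine (Prov.imp_disjList_of_mem ?_).trans (Prov.a2r _ _)
        exact List.mem_cons_of_mem _
          (List.mem_append_right _ (List.mem_filter.2 ⟨hD, by simpa using hDY⟩))
      · exact Prov.a2l _ _
end

section
/- If X and Y are theories, then X ⊳ Y = {C : there exists a formula A with A → C ∈ X and A ∈ Y} is a theory (provided it is nonempty). -/
def ogt {α : Type} (X Y : Set (Formula α)) : Set (Formula α) :=
  {C | ∃ A : Formula α, A.imp C ∈ X ∧ A ∈ Y}

theorem IsTheory.mem_of_imp {α : Type} {X : Set (Formula α)} (hX : IsTheory X)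
    {A B : Formula α} (hA : A ∈ X) (h : Prov (A.imp B)) : B ∈ X :=
  hX.2 B ⟨A, [], hA, by simp, h⟩

theorem IsTheory.conj_mem {α : Type} {X : Set (Formula α)} (hX : IsTheory X)
    {A B : Formula α} (hA : A ∈ X) (hB : B ∈ X) : A.conj B ∈ X :=
  hX.2 _ ⟨A, [B], hA, by simpa using hB, Prov.a1 _⟩

theorem conjList_mem {α : Type} {X : Set (Formula α)}
    (hX : ∀ A ∈ X, ∀ B ∈ X, A.conj B ∈ X) (l : List (Formula α)) :
    ∀ A ∈ X, (∀ C ∈ l, C ∈ X) → conjList A l ∈ X := by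
  induction l with
  | nil => exact fun A hA _ => hA
  | cons B l ih =>
    intro A hA hl
    rw [List.forall_mem_cons] at hl
    exact ih _ (hX A hA B hl.1) hl.2

theorem isTheory_of_closed {α : Type} {X : Set (Formula α)} (hne : X.Nonempty)
    (hconj : ∀ A ∈ X, ∀ B ∈ X, A.conj B ∈ X)
    (himp : ∀ A ∈ X, ∀ B, Prov (A.imp B) → B ∈ X) : IsTheory X := by
  refine ⟨hne, ?_⟩
  rintro B ⟨A, l, hA, hl, h⟩
  exact himp _ (conjList_mem hconj l A hA hl) B h

theorem ogt_theory {α : Type} (X Y : Set (Formula α))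
    (hX : IsTheory X) (hY : IsTheory Y) (hne : (ogt X Y).Nonempty) :
    IsTheory (ogt X Y) := by
  refine isTheory_of_closed hne ?_ ?_
  · rintro C ⟨A, hAC, hA⟩ D ⟨B, hBD, hB⟩
    have hC : (A.conj B).imp C ∈ X := hX.mem_of_imp hAC (Prov.r4 C (Prov.a3l A B))
    have hD : (A.conj B).imp D ∈ X := hX.mem_of_imp hBD (Prov.r4 D (Prov.a3r A B))
    exact ⟨A.conj B, hX.mem_of_imp (hX.conj_mem hC hD) (Prov.a5 _ C D), hY.conj_mem hA hB⟩
  · rintro C ⟨A, hAC, hA⟩ D hCD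
    exact ⟨A, hX.mem_of_imp hAC (Prov.r3 A hCD), hA⟩
end
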